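/- Let n ≥ 2 and let A be an n-qubit architecture with R = T·L gates that is the concatenation of T consecutive causal slices of L gates each, where T ≤ 4^n − 1. Then there exists a point x = (C_1, …, C_R) ∈ SU(4)^{×R} all of whose entries are Clifford gates such that the rank of the differential of the contraction map F^A at x is at least T; in particular r_max(A) ≥ T. -/

import Mathlib

open scoped Matrix ENNReal Classical Kronecker ComplexOrder
open MeasureTheory

/-! ## Basic objects: qubit bases, gates, architectures, contraction maps -/

/-- Computational-basis index set for `n` qubits. -/
abbrev QubitBasis (n : ℕ) := Fin n → Fin 2

/-- `2^n × 2^n` complex matrices, indexed by the computational basis of `n` qubits. -/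
abbrev NMatrix (n : ℕ) := Matrix (QubitBasis n) (QubitBasis n) ℂ

/-- The special unitary group `SU(4)` of two-qubit gates. -/
abbrev SU4 := Matrix.specialUnitaryGroup (Fin 4) ℂ

/-- An architecture on `n` qubits with `R` gates: a list of ordered pairs of distinct qubits. -/
def Architecture (n R : ℕ) := Fin R → {p : Fin n × Fin n // p.1 ≠ p.2}

/-- Identification of a pair of one-qubit basis indices with a two-qubit basis index. -/
def pairIdx (a b : Fin 2) : Fin 4 := ⟨2 * a.val + b.val, by omega⟩

/-- The `n`-qubit matrix given by letting the two-qubit matrix `u` act on the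
tensor factors `p.1` and `p.2`, and as the identity on all other factors. -/
noncomputable def embedGate {n : ℕ} (p : Fin n × Fin n) (u : Matrix (Fin 4) (Fin 4) ℂ) :
    NMatrix n := fun a b =>
  if (∀ i, i ≠ p.1 → i ≠ p.2 → a i = b i)
  then u (pairIdx (a p.1) (a p.2)) (pairIdx (b p.1) (b p.2)) else 0

/-- The list of `n`-qubit gates obtained by substituting the gates `x` into
the architecture `A`. -/
noncomputable def gateList {n R : ℕ} (A : Architecture n R) (x : Fin R → SU4) :
    List (NMatrix n) :=
  List.ofFn fun i => embedGate (A i).1 (x i : Matrix (Fin 4) (Fin 4) ℂ)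

/-- The contraction map `F^A` of an architecture `A`: it sends a tuple of two-qubit gates
`(u_1, …, u_R)` to the `n`-qubit unitary `(u_R)_{p_R} ⋯ (u_1)_{p_1}`. -/
noncomputable def contract {n R : ℕ} (A : Architecture n R) (x : Fin R → SU4) : NMatrix n :=
  ((gateList A x).reverse).prod

/-- The exact circuit complexity: the least number `R` of two-qubit gates, arranged in any
architecture, implementing the matrix `U`. -/
noncomputable def Cu (n : ℕ) (U : NMatrix n) : ℕ :=
  sInf {R | ∃ A : Architecture n R, ∃ x : Fin R → SU4, contract A x = U}

/-- The all-zeros computational basis state `|0^n⟩`. -/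
noncomputable def ket0 (n : ℕ) : QubitBasis n → ℂ := fun a => if a = fun _ => 0 then 1 else 0

/-- The exact state complexity: the least number `R` of two-qubit gates, arranged in any
architecture, producing `ψ` from `|0^n⟩`. -/
noncomputable def Cstate (n : ℕ) (ψ : QubitBasis n → ℂ) : ℕ :=
  sInf {R | ∃ A : Architecture n R, ∃ x : Fin R → SU4, (contract A x) *ᵥ ket0 n = ψ}

/-- The gates with indices `lo ≤ i < hi` of `A` form a causal slice with sink qubit `t`:
every qubit `q` is connected to `t` by a path through gates of the slice, taken in
increasing index order. -/
def IsCausalSliceWith {n R : ℕ} (A : Architecture n R) (lo hi : ℕ) (t : Fin n) : Prop :=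
  ∀ q : Fin n, ∃ (m : ℕ) (idx : Fin m → Fin R) (qs : Fin (m + 1) → Fin n),
    StrictMono idx ∧ (∀ l, lo ≤ (idx l : ℕ) ∧ (idx l : ℕ) < hi) ∧
    qs 0 = q ∧ qs (Fin.last m) = t ∧
    ∀ l : Fin m,
      (qs l.castSucc = (A (idx l)).1.1 ∨ qs l.castSucc = (A (idx l)).1.2) ∧
      (qs l.succ = (A (idx l)).1.1 ∨ qs l.succ = (A (idx l)).1.2)

/-- The gates with indices `lo ≤ i < hi` of `A` form a causal slice. -/
def IsCausalSlice {n R : ℕ} (A : Architecture n R) (lo hi : ℕ) : Prop :=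
  ∃ t, IsCausalSliceWith A lo hi t

/-! ## Group, topological, measurable and compactness structure on `SU(4)`,
and its Haar probability measure -/

namespace SU4

theorem star_mem {U : Matrix (Fin 4) (Fin 4) ℂ}
    (hU : U ∈ Matrix.specialUnitaryGroup (Fin 4) ℂ) :
    star U ∈ Matrix.specialUnitaryGroup (Fin 4) ℂ := by
  rw [Matrix.mem_specialUnitaryGroup_iff] at hU ⊢
  refine ⟨Unitary.star_mem hU.1, ?_⟩
  have : (star U).det = star U.det := by
    simp [Matrix.star_eq_conjTranspose, Matrix.det_conjTranspose]
  rw [this, hU.2]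
  simp

noncomputable instance : Group SU4 :=
  { (inferInstance : Monoid SU4) with
    inv := fun U => ⟨star U.1, star_mem U.2⟩
    inv_mul_cancel := fun U => Subtype.ext <| by
      have h := (Matrix.mem_specialUnitaryGroup_iff.mp U.2).1.1
      simpa using h }

instance : IsTopologicalGroup SU4 where
  continuous_mul := by
    apply Continuous.subtype_mk
    exact ((continuous_subtype_val.comp continuous_fst).matrix_mul
      (continuous_subtype_val.comp continuous_snd))
  continuous_inv := by
    apply Continuous.subtype_mk
    exact continuous_star.comp continuous_subtype_val

noncomputable instance : MeasurableSpace (Matrix (Fin 4) (Fin 4) ℂ) :=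
  inferInstanceAs (MeasurableSpace (Fin 4 → Fin 4 → ℂ))

instance : BorelSpace (Matrix (Fin 4) (Fin 4) ℂ) :=
  inferInstanceAs (BorelSpace (Fin 4 → Fin 4 → ℂ))

theorem isClosed :
    IsClosed (Matrix.specialUnitaryGroup (Fin 4) ℂ : Set (Matrix (Fin 4) (Fin 4) ℂ)) := by
  have h1 : IsClosed {M : Matrix (Fin 4) (Fin 4) ℂ | star M * M = 1} :=
    isClosed_eq ((continuous_id.matrix_conjTranspose).matrix_mul continuous_id) continuous_const
  have h2 : IsClosed {M : Matrix (Fin 4) (Fin 4) ℂ | M * star M = 1} :=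
    isClosed_eq (continuous_id.matrix_mul (continuous_id.matrix_conjTranspose)) continuous_const
  have h3 : IsClosed {M : Matrix (Fin 4) (Fin 4) ℂ | M.det = 1} :=
    isClosed_eq continuous_id.matrix_det continuous_const
  have : (Matrix.specialUnitaryGroup (Fin 4) ℂ : Set (Matrix (Fin 4) (Fin 4) ℂ)) =
      ({M | star M * M = 1} ∩ {M | M * star M = 1}) ∩ {M | M.det = 1} := by
    ext M
    simp only [SetLike.mem_coe, Matrix.mem_specialUnitaryGroup_iff, Matrix.unitaryGroup, Unitary.mem_iff,
      Set.mem_inter_iff, Set.mem_setOf_eq]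
  rw [this]
  exact ((h1.inter h2)).inter h3

theorem isCompact :
    IsCompact (Matrix.specialUnitaryGroup (Fin 4) ℂ : Set (Matrix (Fin 4) (Fin 4) ℂ)) := by
  have hK : IsCompact (Set.pi Set.univ fun _ : Fin 4 => Set.pi Set.univ fun _ : Fin 4 =>
      Metric.closedBall (0 : ℂ) 1 : Set (Matrix (Fin 4) (Fin 4) ℂ)) :=
    isCompact_univ_pi fun _ => isCompact_univ_pi fun _ => isCompact_closedBall _ _
  refine IsCompact.of_isClosed_subset hK isClosed ?_
  intro M hM
  refine fun i _ => fun j _ => ?_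
  simp only [Metric.mem_closedBall, dist_zero_right]
  exact entry_norm_bound_of_unitary (Matrix.mem_specialUnitaryGroup_iff.mp hM).1 i j

instance : CompactSpace SU4 :=
  isCompact_iff_compactSpace.mp isCompact

noncomputable instance : MeasurableSpace SU4 := borel SU4

instance : BorelSpace SU4 := ⟨rfl⟩

end SU4

/-- The Haar probability measure on `SU(4)`. -/
noncomputable def haarSU4 : Measure SU4 :=
  Measure.haarMeasure ⟨⟨Set.univ, isCompact_univ⟩, by simp⟩

instance : IsProbabilityMeasure haarSU4 := by
  constructor
  have h : Measure.haarMeasure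
      (⟨⟨Set.univ, isCompact_univ⟩, by simp⟩ : TopologicalSpace.PositiveCompacts SU4)
      (⟨⟨Set.univ, isCompact_univ⟩, by simp⟩ : TopologicalSpace.PositiveCompacts SU4) = 1 :=
    Measure.haarMeasure_self
  simpa [haarSU4] using h

/-- The product of Haar probability measures on `SU(4)^{×R}`: the distribution of a random
quantum circuit with `R` gates in a fixed architecture. -/
noncomputable def muSU4 (R : ℕ) : Measure (Fin R → SU4) :=
  Measure.pi fun _ => haarSU4

/-! ## The differential of the contraction map, its rank, and the accessible dimension -/

/-- The Lie algebra `su(m)` of traceless skew-Hermitian matrices, as a real subspace. -/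
noncomputable def suAlgebra (m : Type*) [Fintype m] [DecidableEq m] :
    Submodule ℝ (Matrix m m ℂ) :=
  Submodule.span ℝ {H | Hᴴ = -H ∧ H.trace = 0}

/-- `embedGate` as a real-linear map in the gate entry. -/
noncomputable def embedLin {n : ℕ} (p : Fin n × Fin n) :
    Matrix (Fin 4) (Fin 4) ℂ →ₗ[ℝ] NMatrix n where
  toFun := embedGate p
  map_add' u v := by
    funext a b
    simp only [embedGate, Matrix.add_apply]
    split <;> simp
  map_smul' r u := by
    funext a b
    simp only [embedGate, Matrix.smul_apply, RingHom.id_apply]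
    split <;> simp

/-- The differential of the contraction map `F^A` at the point `x ∈ SU(4)^{×R}`, read in the
exponential charts: the direction `(H_1, …, H_R)` is mapped to
`∑_j (U_R)_{p_R} ⋯ (U_{j+1})_{p_{j+1}} · (H_j)_{p_j} · (U_j)_{p_j} ⋯ (U_1)_{p_1}`. -/
noncomputable def contractDiff {n R : ℕ} (A : Architecture n R) (x : Fin R → SU4) :
    (Fin R → Matrix (Fin 4) (Fin 4) ℂ) →ₗ[ℝ] NMatrix n :=
  ∑ j : Fin R,
    (LinearMap.mulLeft ℝ (((gateList A x).drop (j + 1)).reverse.prod)) ∘ₗ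
      (LinearMap.mulRight ℝ
        (embedGate (A j).1 (x j : Matrix (Fin 4) (Fin 4) ℂ) *
          ((gateList A x).take j).reverse.prod)) ∘ₗ
      (embedLin (A j).1) ∘ₗ
      (LinearMap.proj j)

/-- The rank of (the differential of) the contraction map `F^A` at `x`: the dimension of
the image, under the differential, of the tangent space `su(4)^{×R}`. -/
noncomputable def rankAt {n R : ℕ} (A : Architecture n R) (x : Fin R → SU4) : ℕ :=
  Module.finrank ℝ
    ↥(Submodule.map (contractDiff A x) (Submodule.pi Set.univ fun _ => suAlgebra (Fin 4)))

/-- The maximal rank `r_max` of the contraction map `F^A` over all points of `SU(4)^{×R}`. -/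
noncomputable def rmax {n R : ℕ} (A : Architecture n R) : ℕ := ⨆ x, rankAt A x

/-- A matrix viewed as a point of the Euclidean (Frobenius) space of its entries. -/
noncomputable def toEuc {n : ℕ} (M : NMatrix n) :
    EuclideanSpace ℂ (QubitBasis n × QubitBasis n) :=
  WithLp.toLp 2 fun p => M p.1 p.2

/-- The Frobenius norm `‖X‖_F = (tr (X† X))^{1/2}` of an `n`-qubit matrix. -/
noncomputable def frobNorm {n : ℕ} (M : NMatrix n) : ℝ := ‖toEuc M‖

/-- The accessible dimension `d_A` of an architecture `A`: the Hausdorff dimension of the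
set `U(A)` of unitaries implementable with `A`, with respect to the Frobenius metric. -/
noncomputable def accessibleDim {n R : ℕ} (A : Architecture n R) : ℝ≥0∞ :=
  dimH (toEuc '' Set.range (contract A))

/-! ## Pauli strings and Clifford gates -/

/-- The Pauli matrices `1, X, Y, Z`. -/
noncomputable def pauli : Fin 4 → Matrix (Fin 2) (Fin 2) ℂ
  | 0 => 1
  | 1 => !![0, 1; 1, 0]
  | 2 => !![0, -Complex.I; Complex.I, 0]
  | 3 => !![1, 0; 0, -1]

/-- The `n`-qubit Pauli string `⨂ᵢ pauli (s i)`. -/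
noncomputable def pauliString {n : ℕ} (s : Fin n → Fin 4) : NMatrix n :=
  fun a b => ∏ i, pauli (s i) (a i) (b i)

/-- A two-qubit Pauli string, as a `4 × 4` matrix. -/
noncomputable def pauli2 (s : Fin 2 → Fin 4) : Matrix (Fin 4) (Fin 4) ℂ :=
  fun a b =>
    pauli (s 0) ⟨a.val / 2, by have := a.isLt; omega⟩ ⟨b.val / 2, by have := b.isLt; omega⟩ *
    pauli (s 1) ⟨a.val % 2, by have := a.isLt; omega⟩ ⟨b.val % 2, by have := b.isLt; omega⟩

/-- A two-qubit gate is Clifford if it maps every Pauli string to a scalar multiple of a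
Pauli string under conjugation. -/
def IsCliffordGate (u : Matrix (Fin 4) (Fin 4) ℂ) : Prop :=
  ∀ s : Fin 2 → Fin 4, ∃ (c : ℂ) (s' : Fin 2 → Fin 4),
    u * pauli2 s * uᴴ = c • pauli2 s'

/-- Application to the state `|0^n⟩`, `M ↦ M |0^n⟩`, as a real-linear map. -/
noncomputable def mulVecKet0 (n : ℕ) : NMatrix n →ₗ[ℝ] (QubitBasis n → ℂ) where
  toFun M := M *ᵥ ket0 n
  map_add' M N := Matrix.add_mulVec M N (ket0 n)
  map_smul' r M := by
    simp only [RingHom.id_apply]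
    exact Matrix.smul_mulVec r M (ket0 n)

/-- The rank of (the differential of) the map `G^A : x ↦ F^A(x)|0^n⟩` at `x`. -/
noncomputable def stateRankAt {n R : ℕ} (A : Architecture n R) (x : Fin R → SU4) : ℕ :=
  Module.finrank ℝ
    ↥(Submodule.map ((mulVecKet0 n) ∘ₗ contractDiff A x)
      (Submodule.pi Set.univ fun _ => suAlgebra (Fin 4)))

/-! ## Trace norm and operator norm -/

open scoped MatrixOrder in
/-- The trace norm `‖M‖₁ = tr ((M† M)^{1/2})` of a square complex matrix. -/
noncomputable def traceNorm {m : Type*} [Fintype m] [DecidableEq m] (M : Matrix m m ℂ) : ℝ :=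
  ((CFC.sqrt (Mᴴ * M)).trace).re

/-- The operator norm (largest singular value) of a square complex matrix: the norm of the
induced operator between Euclidean spaces. -/
noncomputable def opNorm {m : Type*} [Fintype m] [DecidableEq m] (M : Matrix m m ℂ) : ℝ :=
  ‖LinearMap.toContinuousLinearMap (Matrix.toEuclideanLin M)‖

/-! ## The uniform measure on a finite index set -/

/-- The uniform probability measure on `Fin m`. -/
noncomputable def uniformFin (m : ℕ) : Measure (Fin m) :=
  ((m : ℝ≥0∞))⁻¹ • Measure.count

instance (m : ℕ) : IsFiniteMeasure (uniformFin m) := by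
  constructor
  rw [uniformFin, Measure.smul_apply, smul_eq_mul, Measure.count_univ,
    ENat.card_eq_coe_fintype_card, Fintype.card_fin, ENat.toENNReal_coe]
  rcases Nat.eq_zero_or_pos m with h | h
  · simp [h]
  · rw [ENNReal.inv_mul_cancel (by exact_mod_cast h.ne') (by simp)]
    exact ENNReal.one_lt_top


namespace CliffordRank

/-! ### Single- and two-qubit Pauli algebra -/

def pmul (a b : Fin 4) : Fin 4 :=
  if a = 0 then b else if b = 0 then a else if a = b then 0 else
    if a + b = 3 then 3 else if a + b = 0 then 2 else 1

def psgn (a b : Fin 4) : ℤ := if a = 0 ∨ b = 0 ∨ a = b then 1 else -1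

theorem pauli_mul (a b : Fin 4) : ∃ c : ℂ, pauli a * pauli b = c • pauli (pmul a b) := by
  have key : ∀ (M N : Matrix (Fin 2) (Fin 2) ℂ), (∃ c : ℂ, M 0 0 = c * N 0 0 ∧ M 0 1 = c * N 0 1 ∧
      M 1 0 = c * N 1 0 ∧ M 1 1 = c * N 1 1) → ∃ c : ℂ, M = c • N := by
    rintro M N ⟨c, h1, h2, h3, h4⟩
    refine ⟨c, ?_⟩
    ext i j
    fin_cases i <;> fin_cases j <;> simpa
  apply key
  fin_cases a <;> fin_cases b <;> simp [pauli, pmul, Matrix.mul_apply, Fin.sum_univ_two] <;>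
   first
   | done
   | (refine ⟨Complex.I, ?_⟩; simp; done)
   | (refine ⟨-Complex.I, ?_⟩; simp; done)

theorem pauli_comm (a b : Fin 4) : pauli b * pauli a = (psgn a b : ℂ) • (pauli a * pauli b) := by
  fin_cases a <;> fin_cases b <;> ext i j <;> fin_cases i <;> fin_cases j <;>
    simp [pauli, psgn, Matrix.mul_apply, Fin.sum_univ_two]

theorem pauli_sq (a : Fin 4) : pauli a * pauli a = 1 := by
  fin_cases a <;> ext i j <;> fin_cases i <;> fin_cases j <;>
    simp [pauli, Matrix.mul_apply, Fin.sum_univ_two]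

theorem pauli_herm (a : Fin 4) : (pauli a)ᴴ = pauli a := by
  fin_cases a <;> ext i j <;> fin_cases i <;> fin_cases j <;>
    simp [pauli]

theorem pauli_tr (a b : Fin 4) :
    ∑ i, ∑ j, pauli a i j * pauli b j i = if a = b then 2 else 0 := by
  fin_cases a <;> fin_cases b <;> simp [pauli, Fin.sum_univ_two] <;> norm_num

def kr (M N : Matrix (Fin 2) (Fin 2) ℂ) : Matrix (Fin 4) (Fin 4) ℂ :=
  fun a b =>
    M ⟨a.val / 2, by have := a.isLt; omega⟩ ⟨b.val / 2, by have := b.isLt; omega⟩ *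
    N ⟨a.val % 2, by have := a.isLt; omega⟩ ⟨b.val % 2, by have := b.isLt; omega⟩

theorem kr_mul (M N M' N' : Matrix (Fin 2) (Fin 2) ℂ) :
    kr M N * kr M' N' = kr (M * M') (N * N') := by
  ext a b
  simp only [kr, Matrix.mul_apply, Fin.sum_univ_four, Fin.sum_univ_two]
  simp
  ring

theorem kr_one : kr 1 1 = 1 := by
  ext a b
  fin_cases a <;> fin_cases b <;> simp [kr, Matrix.one_apply]

theorem kr_smul (c d : ℂ) (M N : Matrix (Fin 2) (Fin 2) ℂ) :
    kr (c • M) (d • N) = (c * d) • kr M N := by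
  ext a b
  simp [kr]; ring

theorem kr_herm (M N : Matrix (Fin 2) (Fin 2) ℂ) : (kr M N)ᴴ = kr Mᴴ Nᴴ := by
  ext a b
  simp [kr]

theorem pauli2_kr (s : Fin 2 → Fin 4) : pauli2 s = kr (pauli (s 0)) (pauli (s 1)) := rfl

theorem pauli2_mul (s t : Fin 2 → Fin 4) :
    ∃ (c : ℂ) (r : Fin 2 → Fin 4), pauli2 s * pauli2 t = c • pauli2 r := by
  obtain ⟨c, hc⟩ := pauli_mul (s 0) (t 0)
  obtain ⟨d, hd⟩ := pauli_mul (s 1) (t 1)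
  refine ⟨c * d, ![pmul (s 0) (t 0), pmul (s 1) (t 1)], ?_⟩
  rw [pauli2_kr, pauli2_kr, kr_mul, hc, hd, kr_smul]
  rfl

theorem pauli2_comm (s t : Fin 2 → Fin 4) :
    pauli2 t * pauli2 s =
      ((psgn (s 0) (t 0) * psgn (s 1) (t 1) : ℤ) : ℂ) • (pauli2 s * pauli2 t) := by
  rw [pauli2_kr, pauli2_kr, kr_mul, kr_mul, pauli_comm (s 0), pauli_comm (s 1), kr_smul]
  push_cast
  rfl

theorem psgn_cases (a b : Fin 4) : psgn a b = 1 ∨ psgn a b = -1 := by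
  unfold psgn; split <;> simp

theorem pauli2_comm' (s t : Fin 2 → Fin 4) :
    pauli2 t * pauli2 s = pauli2 s * pauli2 t ∨ pauli2 t * pauli2 s = - (pauli2 s * pauli2 t) := by
  rw [pauli2_comm s t]
  rcases psgn_cases (s 0) (t 0) with h | h <;> rcases psgn_cases (s 1) (t 1) with h' | h' <;>
    simp [h, h']

theorem pauli2_sq (s : Fin 2 → Fin 4) : pauli2 s * pauli2 s = 1 := by
  rw [pauli2_kr, kr_mul, pauli_sq, pauli_sq, kr_one]

theorem pauli2_herm (s : Fin 2 → Fin 4) : (pauli2 s)ᴴ = pauli2 s := by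
  rw [pauli2_kr, kr_herm, pauli_herm, pauli_herm]

theorem pauli2_tr (s : Fin 2 → Fin 4) (hs : s ≠ 0) : (pauli2 s).trace = 0 := by
  obtain ⟨a, ha⟩ : ∃ a, s 0 = a := ⟨_, rfl⟩
  obtain ⟨b, hb⟩ : ∃ b, s 1 = b := ⟨_, rfl⟩
  have hab : ¬ (a = 0 ∧ b = 0) := by
    rintro ⟨rfl, rfl⟩
    apply hs; ext i; fin_cases i <;> simp [ha, hb]
  rw [pauli2_kr, ha, hb, Matrix.trace, Fin.sum_univ_four]
  have e : ∀ M N : Matrix (Fin 2) (Fin 2) ℂ, (kr M N).diag 0 + (kr M N).diag 1 + (kr M N).diag 2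
      + (kr M N).diag 3 = (M 0 0 + M 1 1) * (N 0 0 + N 1 1) := by
    intro M N; simp [kr]; ring
  rw [e]
  fin_cases a <;> fin_cases b <;> simp [pauli] at hab ⊢

theorem clifford_mul {u v : Matrix (Fin 4) (Fin 4) ℂ} (hu : IsCliffordGate u)
    (hv : IsCliffordGate v) : IsCliffordGate (u * v) := by
  intro s
  obtain ⟨c, s', h⟩ := hv s
  obtain ⟨d, s'', h'⟩ := hu s'
  refine ⟨c * d, s'', ?_⟩
  rw [Matrix.conjTranspose_mul]
  calc u * v * pauli2 s * (vᴴ * uᴴ) = u * (v * pauli2 s * vᴴ) * uᴴ := by noncomm_ring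
    _ = _ := by rw [h, Matrix.mul_smul, Matrix.smul_mul, h', smul_smul]

/-- Normalising a unitary to determinant one without changing its conjugation action. -/
theorem exists_su4 (u : Matrix (Fin 4) (Fin 4) ℂ) (h1 : uᴴ * u = 1) :
    ∃ g : SU4, ∀ M, (g : Matrix (Fin 4) (Fin 4) ℂ) * M * (g : Matrix (Fin 4) (Fin 4) ℂ)ᴴ
      = u * M * uᴴ := by
  have h2 : u * uᴴ = 1 := mul_eq_one_comm.mp h1
  have hdet : star u.det * u.det = 1 := by
    rw [← Matrix.det_conjTranspose, ← Matrix.det_mul, h1, Matrix.det_one]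
  have hne : u.det ≠ 0 := by
    intro h; rw [h] at hdet; simp at hdet
  obtain ⟨z, hz⟩ := IsAlgClosed.exists_pow_nat_eq (u.det)⁻¹ (n := 4) (by norm_num)
  have hn : ‖u.det‖ = 1 := by
    have := congrArg norm hdet
    rw [norm_mul, norm_star, norm_one] at this
    nlinarith [norm_nonneg u.det]
  have hzn : ‖z‖ = 1 := by
    have := congrArg norm hz
    rw [norm_pow, norm_inv, hn, inv_one] at this
    exact (pow_eq_one_iff_of_nonneg (norm_nonneg z) (by norm_num)).mp this
  have hzz : z * star z = 1 := by
    have : z * (starRingEnd ℂ) z = 1 := by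
      rw [Complex.mul_conj, Complex.normSq_eq_norm_sq, hzn]; simp
    exact this
  have hzz' : star z * z = 1 := by rw [mul_comm]; exact hzz
  refine ⟨⟨z • u, ?_⟩, ?_⟩
  · rw [Matrix.mem_specialUnitaryGroup_iff, Matrix.mem_unitaryGroup_iff]
    constructor
    · rw [Matrix.star_eq_conjTranspose, Matrix.conjTranspose_smul, Matrix.smul_mul,
        Matrix.mul_smul, smul_smul, h2, hzz, one_smul]
    · rw [Matrix.det_smul, Fintype.card_fin, hz, inv_mul_cancel₀ hne]
  · intro M
    change (z • u) * M * (z • u)ᴴ = _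
    rw [Matrix.conjTranspose_smul, Matrix.smul_mul, Matrix.smul_mul,
        Matrix.mul_smul, smul_smul, hzz, one_smul]

theorem exists_anti (s t : Fin 2 → Fin 4) (h : psgn (s 0) (t 0) * psgn (s 1) (t 1) = -1) :
    ∃ u : Matrix (Fin 4) (Fin 4) ℂ, uᴴ * u = 1 ∧ IsCliffordGate u ∧
      u * pauli2 s * uᴴ = pauli2 t := by
  have hc := pauli2_comm s t
  rw [h] at hc
  have hr : ∃ r : ℂ, r * r = 1 / 2 ∧ star r = r := by
    refine ⟨((Real.sqrt (1/2) : ℝ) : ℂ), ?_, by simp⟩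
    rw [← Complex.ofReal_mul, Real.mul_self_sqrt (by norm_num)]; norm_num
  obtain ⟨r, hr, hrs⟩ := hr
  set P := pauli2 s with hP
  set Q := pauli2 t with hQ
  have hPP : P * P = 1 := pauli2_sq s
  have hQQ : Q * Q = 1 := pauli2_sq t
  have hQP : Q * P = - (P * Q) := by simpa using hc
  have hstar : (r • (P + Q))ᴴ = r • (P + Q) := by
    rw [Matrix.conjTranspose_smul, Matrix.conjTranspose_add, hrs, hP, hQ, pauli2_herm, pauli2_herm]
  have hconj : ∀ M, (r • (P + Q)) * M * (r • (P + Q))ᴴ = (1 / 2 : ℂ) • ((P + Q) * M * (P + Q)) := by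
    intro M
    rw [hstar, Matrix.smul_mul, Matrix.smul_mul, Matrix.mul_smul, smul_smul, hr]
  refine ⟨r • (P + Q), ?_, ?_, ?_⟩
  · rw [hstar, Matrix.smul_mul, Matrix.mul_smul, smul_smul, hr]
    have : (P + Q) * (P + Q) = (2 : ℂ) • 1 := by
      rw [add_mul, mul_add, mul_add, hPP, hQQ, hQP, two_smul]; abel
    rw [this, smul_smul]; norm_num
  · intro w
    rw [hconj]
    have e : (P + Q) * pauli2 w * (P + Q) = P * pauli2 w * (P + Q) + Q * pauli2 w * (P + Q) := by
      noncomm_ring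
    obtain ⟨c, x, hx⟩ := pauli2_mul w s
    obtain ⟨d, y, hy⟩ := pauli2_mul x t
    have hpq : (pauli2 w) * P * Q = (c * d) • pauli2 y := by
      rw [hx, Matrix.smul_mul, hy, smul_smul]
    have h3 : (P + Q) * (P + Q) = (2 : ℂ) • 1 := by
      rw [add_mul, mul_add, mul_add, hPP, hQQ, hQP, two_smul]; abel
    have h4 : (P - Q) * (P + Q) = (2 : ℂ) • (P * Q) := by
      rw [sub_mul, mul_add, mul_add, hPP, hQQ, hQP, two_smul]; abel
    rcases pauli2_comm' w s with h1 | h1 <;> rcases pauli2_comm' w t with h2 | h2 <;>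
      rw [← hP] at h1 <;> rw [← hQ] at h2
    · refine ⟨1, w, ?_⟩
      have : (P + Q) * pauli2 w * (P + Q) = pauli2 w * ((P + Q) * (P + Q)) := by
        rw [e, h1, h2]; noncomm_ring
      rw [this, h3, Matrix.mul_smul, smul_smul, Matrix.mul_one]; norm_num
    · refine ⟨c * d, y, ?_⟩
      have : (P + Q) * pauli2 w * (P + Q) = pauli2 w * ((P - Q) * (P + Q)) := by
        rw [e, h1, h2]; noncomm_ring
      rw [this, h4, Matrix.mul_smul, smul_smul, ← Matrix.mul_assoc, hpq]; norm_num
    · refine ⟨-(c * d), y, ?_⟩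
      have : (P + Q) * pauli2 w * (P + Q) = - (pauli2 w * ((P - Q) * (P + Q))) := by
        rw [e, h1, h2]; noncomm_ring
      rw [this, h4, Matrix.mul_smul, smul_neg, smul_smul, ← Matrix.mul_assoc, hpq]; norm_num
    · refine ⟨-1, w, ?_⟩
      have : (P + Q) * pauli2 w * (P + Q) = - (pauli2 w * ((P + Q) * (P + Q))) := by
        rw [e, h1, h2]; noncomm_ring
      rw [this, h3, Matrix.mul_smul, smul_neg, smul_smul, Matrix.mul_one]; norm_num
  · rw [hconj]
    have : (P + Q) * P * (P + Q) = (2 : ℂ) • Q := by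
      calc (P + Q) * P * (P + Q) = P * P * P + P * P * Q + (Q * P) * P + (Q * P) * Q := by
            noncomm_ring
        _ = P * P * P + P * P * Q + -(P * Q) * P - P * (Q * Q) := by rw [hQP]; noncomm_ring
        _ = P + Q - P * (Q * P) - P := by rw [hPP, hQQ]; noncomm_ring
        _ = P + Q + P * P * Q - P := by rw [hQP]; noncomm_ring
        _ = _ := by rw [hPP, two_smul]; noncomm_ring
    rw [this, smul_smul]; norm_num

theorem clifford_one : IsCliffordGate 1 := by
  intro s; exact ⟨1, s, by simp⟩

theorem two_step : ∀ (k : Bool) (a b : Fin 4), (a = 0 ∧ b = 0) ∨ ∃ a' b' a'' b'' : Fin 4,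
    psgn a a' * psgn b b' = -1 ∧ psgn a' a'' * psgn b' b'' = -1 ∧
      (if k then b'' = 0 else a'' = 0) := by
  unfold psgn
  decide

/-- Concentrating a two-qubit Pauli on one chosen factor. -/
theorem exists_move (k : Bool) (s : Fin 2 → Fin 4) :
    ∃ g : SU4, IsCliffordGate (g : Matrix (Fin 4) (Fin 4) ℂ) ∧ ∃ s' : Fin 2 → Fin 4,
      (if k then s' 1 = 0 else s' 0 = 0) ∧
      (g : Matrix (Fin 4) (Fin 4) ℂ) * pauli2 s * (g : Matrix (Fin 4) (Fin 4) ℂ)ᴴ = pauli2 s' := by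
  rcases two_step k (s 0) (s 1) with ⟨h0, h1⟩ | ⟨a', b', a'', b'', h1, h2, h3⟩
  · refine ⟨1, ?_, s, ?_, ?_⟩
    · exact clifford_one
    · cases k <;> simp [h0, h1]
    · simp
  · obtain ⟨u, hu1, hu2, hu3⟩ := exists_anti s ![a', b'] h1
    obtain ⟨v, hv1, hv2, hv3⟩ := exists_anti ![a', b'] ![a'', b''] h2
    have hvu : (v * u)ᴴ * (v * u) = 1 := by
      rw [Matrix.conjTranspose_mul]
      calc uᴴ * vᴴ * (v * u) = uᴴ * (vᴴ * v) * u := by noncomm_ring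
        _ = 1 := by rw [hv1, Matrix.mul_one, hu1]
    obtain ⟨g, hg⟩ := exists_su4 (v * u) hvu
    refine ⟨g, ?_, ![a'', b''], ?_, ?_⟩
    · intro w
      rw [hg]
      exact clifford_mul hv2 hu2 w
    · simpa using h3
    · rw [hg, Matrix.conjTranspose_mul]
      calc v * u * pauli2 s * (uᴴ * vᴴ) = v * (u * pauli2 s * uᴴ) * vᴴ := by noncomm_ring
        _ = _ := by rw [hu3, hv3]

/-! ### Embedding into `n` qubits -/

def rest {n : ℕ} (p : Fin n × Fin n) : Finset (Fin n) := (Finset.univ.erase p.1).erase p.2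

theorem mem_rest {n : ℕ} (p : Fin n × Fin n) (i : Fin n) : i ∈ rest p ↔ i ≠ p.2 ∧ i ≠ p.1 := by
  simp [rest]

def gm {n : ℕ} (p : Fin n × Fin n) (M : Matrix (Fin 4) (Fin 4) ℂ)
    (N : Fin n → Matrix (Fin 2) (Fin 2) ℂ) : NMatrix n := fun a b =>
  M (pairIdx (a p.1) (a p.2)) (pairIdx (b p.1) (b p.2)) * ∏ i ∈ rest p, N i (a i) (b i)

theorem embed_mul_gm {n : ℕ} (p : Fin n × Fin n) (hp : p.1 ≠ p.2)
    (u M : Matrix (Fin 4) (Fin 4) ℂ) (N : Fin n → Matrix (Fin 2) (Fin 2) ℂ) :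
    embedGate p u * gm p M N = gm p (u * M) N := by
  ext a b
  rw [Matrix.mul_apply]
  let f : Fin 2 × Fin 2 → QubitBasis n := fun z =>
    Function.update (Function.update a p.1 z.1) p.2 z.2
  have f1 : ∀ z, f z p.1 = z.1 := fun z => by simp [f, Function.update_of_ne hp]
  have f2 : ∀ z, f z p.2 = z.2 := fun z => by simp [f]
  have f3 : ∀ z i, i ≠ p.1 → i ≠ p.2 → f z i = a i := fun z i h1 h2 => by
    simp [f, Function.update_of_ne h1, Function.update_of_ne h2]
  have hf : Function.Injective f := by
    intro z w h
    ext
    · rw [← f1 z, h, f1]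
    · rw [← f2 z, h, f2]
  rw [← Fintype.sum_of_injective f hf
    (fun z => u (pairIdx (a p.1) (a p.2)) (pairIdx z.1 z.2) *
      (M (pairIdx z.1 z.2) (pairIdx (b p.1) (b p.2)) * ∏ i ∈ rest p, N i (a i) (b i)))]
  · simp only [gm, Matrix.mul_apply, Fintype.sum_prod_type, Fin.sum_univ_two, Fin.sum_univ_four]
    have e0 : pairIdx 0 0 = 0 := rfl
    have e1 : pairIdx 0 1 = 1 := rfl
    have e2 : pairIdx 1 0 = 2 := rfl
    have e3 : pairIdx 1 1 = 3 := rfl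
    rw [e0, e1, e2, e3]
    ring
  · intro c hc
    have : ¬ (∀ i, i ≠ p.1 → i ≠ p.2 → a i = c i) := by
      intro h
      apply hc
      refine ⟨(c p.1, c p.2), ?_⟩
      funext i
      by_cases h1 : i = p.1
      · rw [h1, f1]
      by_cases h2 : i = p.2
      · rw [h2, f2]
      rw [f3 _ _ h1 h2, h i h1 h2]
    simp only [embedGate, if_neg this, zero_mul]
  · intro z
    have : (∀ i, i ≠ p.1 → i ≠ p.2 → a i = f z i) := fun i h1 h2 => (f3 z i h1 h2).symm
    simp only [embedGate, if_pos this, gm, f1, f2]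
    congr 2
    apply Finset.prod_congr rfl
    intro i hi
    rw [mem_rest] at hi
    rw [f3 z i hi.2 hi.1]

theorem embed_transpose {n : ℕ} (p : Fin n × Fin n) (u : Matrix (Fin 4) (Fin 4) ℂ) :
    (embedGate p u)ᵀ = embedGate p uᵀ := by
  ext a b
  simp only [embedGate, Matrix.transpose_apply]
  congr 1
  simp only [eq_comm]

theorem gm_transpose {n : ℕ} (p : Fin n × Fin n) (M : Matrix (Fin 4) (Fin 4) ℂ)
    (N : Fin n → Matrix (Fin 2) (Fin 2) ℂ) : (gm p M N)ᵀ = gm p Mᵀ (fun i => (N i)ᵀ) := rfl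

theorem gm_mul_embed {n : ℕ} (p : Fin n × Fin n) (hp : p.1 ≠ p.2)
    (u M : Matrix (Fin 4) (Fin 4) ℂ) (N : Fin n → Matrix (Fin 2) (Fin 2) ℂ) :
    gm p M N * embedGate p u = gm p (M * u) N := by
  apply Matrix.transpose_injective
  rw [Matrix.transpose_mul, embed_transpose, gm_transpose, embed_mul_gm p hp, gm_transpose,
    Matrix.transpose_mul]

theorem prod_one_apply {n : ℕ} (S : Finset (Fin n)) (a b : QubitBasis n) :
    ∏ i ∈ S, (1 : Matrix (Fin 2) (Fin 2) ℂ) (a i) (b i) = if ∀ i ∈ S, a i = b i then 1 else 0 := by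
  simp only [Matrix.one_apply]
  split_ifs with h
  · exact Finset.prod_eq_one fun i hi => if_pos (h i hi)
  · push Not at h
    obtain ⟨i, hi, h⟩ := h
    exact Finset.prod_eq_zero hi (if_neg h)

theorem embed_eq_gm {n : ℕ} (p : Fin n × Fin n) (u : Matrix (Fin 4) (Fin 4) ℂ) :
    embedGate p u = gm p u (fun _ => 1) := by
  ext a b
  simp only [embedGate, gm, prod_one_apply, mem_rest, mul_ite, mul_one, mul_zero]
  congr 1
  apply propext
  constructor
  · intro h i hi; exact h i hi.2 hi.1
  · intro h i h1 h2; exact h i ⟨h2, h1⟩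

theorem pauli2_pairIdx (s : Fin 2 → Fin 4) (a b c d : Fin 2) :
    pauli2 s (pairIdx a b) (pairIdx c d) = pauli (s 0) a c * pauli (s 1) b d := by
  fin_cases a <;> fin_cases b <;> fin_cases c <;> fin_cases d <;> rfl

theorem pauliString_eq_gm {n : ℕ} (p : Fin n × Fin n) (hp : p.1 ≠ p.2) (s : Fin n → Fin 4) :
    pauliString s = gm p (pauli2 ![s p.1, s p.2]) (fun i => pauli (s i)) := by
  ext a b
  simp only [pauliString, gm, pauli2_pairIdx, rest]
  rw [← Finset.mul_prod_erase Finset.univ _ (Finset.mem_univ p.1),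
    ← Finset.mul_prod_erase (Finset.univ.erase p.1) _ (a := p.2) (by simp [hp.symm])]
  simp [mul_assoc]

theorem pauliString_zero (n : ℕ) : pauliString (0 : Fin n → Fin 4) = 1 := by
  ext a b
  have := prod_one_apply Finset.univ a b
  simp only [pauliString]
  change ∏ i, (1 : Matrix (Fin 2) (Fin 2) ℂ) (a i) (b i) = _
  rw [this, Matrix.one_apply]
  simp [funext_iff]

theorem embed_mul {n : ℕ} (p : Fin n × Fin n) (hp : p.1 ≠ p.2) (u v : Matrix (Fin 4) (Fin 4) ℂ) :
    embedGate p u * embedGate p v = embedGate p (u * v) := by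
  rw [embed_eq_gm p v, embed_mul_gm p hp, embed_eq_gm]

theorem embed_one {n : ℕ} (p : Fin n × Fin n) (hp : p.1 ≠ p.2) :
    embedGate p (1 : Matrix (Fin 4) (Fin 4) ℂ) = 1 := by
  rw [← pauliString_zero, pauliString_eq_gm p hp, embed_eq_gm]
  congr 1
  rw [pauli2_kr, ← kr_one]
  rfl

theorem gm_smul {n : ℕ} (p : Fin n × Fin n) (c : ℂ) (M : Matrix (Fin 4) (Fin 4) ℂ)
    (N : Fin n → Matrix (Fin 2) (Fin 2) ℂ) : gm p (c • M) N = c • gm p M N := by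
  ext a b
  simp [gm, mul_assoc]

theorem su4_left (g : SU4) :
    (g : Matrix (Fin 4) (Fin 4) ℂ)ᴴ * (g : Matrix (Fin 4) (Fin 4) ℂ) = 1 :=
  (Matrix.mem_specialUnitaryGroup_iff.mp g.2).1.1

theorem su4_right (g : SU4) :
    (g : Matrix (Fin 4) (Fin 4) ℂ) * (g : Matrix (Fin 4) (Fin 4) ℂ)ᴴ = 1 :=
  (Matrix.mem_specialUnitaryGroup_iff.mp g.2).1.2

theorem embed_left {n : ℕ} (p : Fin n × Fin n) (hp : p.1 ≠ p.2) (g : SU4) :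
    embedGate p (g : Matrix (Fin 4) (Fin 4) ℂ)ᴴ * embedGate p (g : Matrix (Fin 4) (Fin 4) ℂ) = 1 := by
  rw [embed_mul p hp, su4_left, embed_one p hp]

theorem embed_isUnit {n : ℕ} (p : Fin n × Fin n) (hp : p.1 ≠ p.2) (g : SU4) :
    IsUnit (embedGate p (g : Matrix (Fin 4) (Fin 4) ℂ)) :=
  IsUnit.of_mul_eq_one_right _ (embed_left p hp g)

def upd {n : ℕ} (p : Fin n × Fin n) (s : Fin n → Fin 4) (s' : Fin 2 → Fin 4) : Fin n → Fin 4 :=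
  Function.update (Function.update s p.1 (s' 0)) p.2 (s' 1)

theorem upd_fst {n : ℕ} (p : Fin n × Fin n) (hp : p.1 ≠ p.2) (s : Fin n → Fin 4)
    (s' : Fin 2 → Fin 4) : upd p s s' p.1 = s' 0 := by
  simp [upd, Function.update_of_ne hp]

theorem upd_snd {n : ℕ} (p : Fin n × Fin n) (s : Fin n → Fin 4)
    (s' : Fin 2 → Fin 4) : upd p s s' p.2 = s' 1 := by
  simp [upd]

theorem upd_ne {n : ℕ} (p : Fin n × Fin n) (s : Fin n → Fin 4)
    (s' : Fin 2 → Fin 4) (i : Fin n) (h1 : i ≠ p.1) (h2 : i ≠ p.2) : upd p s s' i = s i := by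
  simp [upd, Function.update_of_ne h1, Function.update_of_ne h2]

theorem embed_pauli {n : ℕ} (p : Fin n × Fin n) (hp : p.1 ≠ p.2) (g : SU4) (s : Fin n → Fin 4)
    (c : ℂ) (s' : Fin 2 → Fin 4)
    (h : (g : Matrix (Fin 4) (Fin 4) ℂ) * pauli2 ![s p.1, s p.2] *
      (g : Matrix (Fin 4) (Fin 4) ℂ)ᴴ = c • pauli2 s') :
    embedGate p (g : Matrix (Fin 4) (Fin 4) ℂ) * pauliString s =
      c • (pauliString (upd p s s') * embedGate p (g : Matrix (Fin 4) (Fin 4) ℂ)) := by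
  rw [pauliString_eq_gm p hp s, embed_mul_gm p hp, pauliString_eq_gm p hp (upd p s s'),
    gm_mul_embed p hp, ← gm_smul, ← Matrix.smul_mul]
  have e : ![upd p s s' p.1, upd p s s' p.2] = s' := by
    rw [upd_fst p hp, upd_snd]; ext i; fin_cases i <;> rfl
  rw [e, ← h, Matrix.mul_assoc _ _ (g : Matrix (Fin 4) (Fin 4) ℂ), su4_left, Matrix.mul_one]
  ext a b
  simp only [gm]
  congr 1
  apply Finset.prod_congr rfl
  intro i hi
  rw [mem_rest] at hi
  rw [upd_ne p s s' i hi.2 hi.1]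

/-! ### Linear independence of Pauli strings -/

theorem pauliString_tr {n : ℕ} (s t : Fin n → Fin 4) :
    (pauliString s * pauliString t).trace = if s = t then (2 : ℂ) ^ n else 0 := by
  have h1 : (pauliString s * pauliString t).trace =
      ∏ i, ∑ z : Fin 2 × Fin 2, pauli (s i) z.1 z.2 * pauli (t i) z.2 z.1 := by
    rw [Finset.prod_univ_sum]
    simp only [Matrix.trace, Matrix.diag, Matrix.mul_apply, Fintype.piFinset_univ]
    rw [← Fintype.sum_prod_type']
    refine Fintype.sum_equiv (Equiv.arrowProdEquivProdArrow (Fin n) (fun _ => Fin 2) (fun _ => Fin 2)).symm _ _ ?_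
    intro z
    simp only [pauliString, ← Finset.prod_mul_distrib]
    rfl
  rw [h1]
  have h2 : ∀ i, (∑ z : Fin 2 × Fin 2, pauli (s i) z.1 z.2 * pauli (t i) z.2 z.1) =
      if s i = t i then (2 : ℂ) else 0 := by
    intro i
    rw [Fintype.sum_prod_type, pauli_tr]
  simp only [h2]
  split_ifs with h
  · subst h; simp
  · obtain ⟨i, hi⟩ := Function.ne_iff.mp h
    exact Finset.prod_eq_zero (Finset.mem_univ i) (if_neg hi)

theorem pauliString_li (n : ℕ) :
    LinearIndependent ℂ (fun s : Fin n → Fin 4 => (pauliString s : NMatrix n)) := by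
  rw [Fintype.linearIndependent_iff]
  intro c hc t
  have := congrArg (fun M => (M * pauliString t).trace) hc
  simp only [Finset.sum_mul, Matrix.trace_sum, Matrix.smul_mul, Matrix.trace_smul,
    pauliString_tr, Matrix.zero_mul, Matrix.trace_zero] at this
  simpa using this

theorem pauliString_ne {n : ℕ} (s : Fin n → Fin 4) : (pauliString s : NMatrix n) ≠ 0 :=
  (pauliString_li n).ne_zero s

/-- intertwining relation: `V P_s = c P_s' V` with `c ≠ 0`. -/
def Tw {n : ℕ} (V : NMatrix n) (s s' : Fin n → Fin 4) : Prop :=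
  ∃ c : ℂ, c ≠ 0 ∧ V * pauliString s = c • (pauliString s' * V)

theorem Tw.trans {n : ℕ} {V W : NMatrix n} {s s' s'' : Fin n → Fin 4} (h : Tw V s s')
    (h' : Tw W s' s'') : Tw (W * V) s s'' := by
  obtain ⟨c, hc, h⟩ := h
  obtain ⟨d, hd, h'⟩ := h'
  refine ⟨c * d, mul_ne_zero hc hd, ?_⟩
  rw [Matrix.mul_assoc, h, Matrix.mul_smul, ← Matrix.mul_assoc, h', Matrix.smul_mul, smul_smul,
    Matrix.mul_assoc]

theorem tw_of {n : ℕ} {V : NMatrix n} (hV : IsUnit V) {s s' : Fin n → Fin 4} {c : ℂ}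
    (h : V * pauliString s = c • (pauliString s' * V)) : Tw V s s' := by
  refine ⟨c, ?_, h⟩
  rintro rfl
  rw [zero_smul] at h
  exact pauliString_ne s ((hV.mul_right_eq_zero).mp h)

theorem Tw.ne_zero {n : ℕ} {V : NMatrix n} (hV : IsUnit V) {s s' : Fin n → Fin 4}
    (h : Tw V s s') (hs : s ≠ 0) : s' ≠ 0 := by
  rintro rfl
  obtain ⟨c, hc, h⟩ := h
  rw [pauliString_zero, Matrix.one_mul] at h
  have h2 : V * pauliString s = V * (c • pauliString 0) := by
    rw [h, pauliString_zero, Matrix.mul_smul, Matrix.mul_one]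
  have h3 := hV.mul_left_cancel h2
  have h4 := pauliString_tr s s
  nth_rewrite 1 [h3] at h4
  rw [Matrix.smul_mul, Matrix.trace_smul, pauliString_tr, if_neg hs.symm] at h4
  simp only [smul_zero, if_true] at h4
  exact pow_ne_zero n two_ne_zero h4.symm

theorem tw_clifford {n : ℕ} (p : Fin n × Fin n) (hp : p.1 ≠ p.2) (g : SU4)
    (hg : IsCliffordGate (g : Matrix (Fin 4) (Fin 4) ℂ)) (s : Fin n → Fin 4) :
    ∃ s', Tw (embedGate p (g : Matrix (Fin 4) (Fin 4) ℂ)) s s' := by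
  obtain ⟨c, s', h⟩ := hg ![s p.1, s p.2]
  exact ⟨_, tw_of (embed_isUnit p hp g) (embed_pauli p hp g s c s' h)⟩

theorem tw_move {n : ℕ} (p : Fin n × Fin n) (hp : p.1 ≠ p.2) (q : Fin n)
    (hq : q = p.1 ∨ q = p.2) (s : Fin n → Fin 4) :
    ∃ g : SU4, IsCliffordGate (g : Matrix (Fin 4) (Fin 4) ℂ) ∧ ∃ s',
      Tw (embedGate p (g : Matrix (Fin 4) (Fin 4) ℂ)) s s' ∧
      (∀ i, s' i ≠ 0 → i = q ∨ (s i ≠ 0 ∧ i ≠ p.1 ∧ i ≠ p.2)) := by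
  obtain ⟨g, hg, s', h1, h2⟩ := exists_move (decide (q = p.1)) ![s p.1, s p.2]
  refine ⟨g, hg, upd p s s', tw_of (embed_isUnit p hp g)
    (embed_pauli p hp g s 1 s' (by rw [h2, one_smul])), ?_⟩
  intro i hi
  by_cases hi1 : i = p.1
  · left
    by_contra hne
    have hq1 : q ≠ p.1 := fun h => hne (hi1.trans h.symm)
    simp [hq1] at h1
    rw [hi1, upd_fst p hp] at hi
    exact hi h1
  by_cases hi2 : i = p.2
  · left
    by_contra hne
    have hq1 : q = p.1 := by
      rcases hq with h | h
      · exact h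
      · exact absurd (hi2.trans h.symm) hne
    simp [hq1] at h1
    rw [hi2, upd_snd p] at hi
    exact hi h1
  · right
    rw [upd_ne p s s' i hi1 hi2] at hi
    exact ⟨hi, hi1, hi2⟩

theorem pauliString_local {n : ℕ} (p : Fin n × Fin n) (hp : p.1 ≠ p.2) (s : Fin n → Fin 4)
    (h : ∀ i, s i ≠ 0 → i = p.1 ∨ i = p.2) :
    pauliString s = embedGate p (pauli2 ![s p.1, s p.2]) := by
  rw [pauliString_eq_gm p hp, embed_eq_gm]
  ext a b
  simp only [gm]
  congr 1
  apply Finset.prod_congr rfl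
  intro i hi
  rw [mem_rest] at hi
  have : s i = 0 := by
    by_contra h0
    rcases h i h0 with h | h
    · exact hi.2 h
    · exact hi.1 h
  rw [this]; rfl

/-! ### Products of gates and causal slices -/

noncomputable def vp {n : ℕ} (p : ℕ → Fin n × Fin n) (g : ℕ → SU4) : ℕ → ℕ → NMatrix n
  | _, 0 => 1
  | i, m + 1 => vp p g (i + 1) m * embedGate (p i) (g i : Matrix (Fin 4) (Fin 4) ℂ)

theorem vp_add {n : ℕ} (p : ℕ → Fin n × Fin n) (g : ℕ → SU4) (a b i : ℕ) :
    vp p g i (a + b) = vp p g (i + a) b * vp p g i a := by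
  induction a generalizing i with
  | zero => simp [vp]
  | succ a ih =>
    rw [show a + 1 + b = (a + b) + 1 by ring]
    simp only [vp]
    rw [ih, Matrix.mul_assoc, show i + 1 + a = i + (a + 1) by ring]

theorem vp_congr {n : ℕ} (p : ℕ → Fin n × Fin n) (g g' : ℕ → SU4) (m i : ℕ)
    (h : ∀ k, i ≤ k → k < i + m → g k = g' k) : vp p g i m = vp p g' i m := by
  induction m generalizing i with
  | zero => rfl
  | succ m ih =>
    simp only [vp]
    rw [ih (i + 1) (fun k h1 h2 => h k (by omega) (by omega)), h i le_rfl (by omega)]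

theorem vp_isUnit {n : ℕ} (p : ℕ → Fin n × Fin n) (hp : ∀ i, (p i).1 ≠ (p i).2) (g : ℕ → SU4)
    (m i : ℕ) : IsUnit (vp p g i m) := by
  induction m generalizing i with
  | zero => exact isUnit_one
  | succ m ih => exact (ih (i + 1)).mul (embed_isUnit (p i) (hp i) (g i))

theorem vp_tw {n : ℕ} (p : ℕ → Fin n × Fin n) (hp : ∀ i, (p i).1 ≠ (p i).2) (g : ℕ → SU4)
    (hg : ∀ i, IsCliffordGate (g i : Matrix (Fin 4) (Fin 4) ℂ)) (m i : ℕ) (s : Fin n → Fin 4) :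
    ∃ s', Tw (vp p g i m) s s' := by
  induction m generalizing i s with
  | zero => exact ⟨s, 1, one_ne_zero, by simp [vp]⟩
  | succ m ih =>
    obtain ⟨s', h'⟩ := tw_clifford (p i) (hp i) (g i) (hg i) s
    obtain ⟨s'', h''⟩ := ih (i + 1) s'
    exact ⟨s'', h'.trans h''⟩

/-- Qubits with a causal path to `t` through the gates `i, …, i + m - 1`. -/
def reach {n : ℕ} (p : ℕ → Fin n × Fin n) (t : Fin n) : ℕ → ℕ → Set (Fin n)
  | _, 0 => {t}
  | i, m + 1 => fun q => reach p t (i + 1) m q ∨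
      ((q = (p i).1 ∨ q = (p i).2) ∧ ∃ r, (r = (p i).1 ∨ r = (p i).2) ∧ reach p t (i + 1) m r)

theorem reach_self {n : ℕ} (p : ℕ → Fin n × Fin n) (t : Fin n) (m i : ℕ) : reach p t i m t := by
  induction m generalizing i with
  | zero => exact rfl
  | succ m ih => exact Or.inl (ih _)

theorem reach_path {n : ℕ} (p : ℕ → Fin n × Fin n) (t : Fin n) (m i : ℕ) (q : Fin n) (k : ℕ)
    (idx : Fin k → ℕ) (qs : Fin (k + 1) → Fin n) (hmono : StrictMono idx)
    (hidx : ∀ l, i ≤ idx l ∧ idx l < i + m) (h0 : qs 0 = q) (ht : qs (Fin.last k) = t)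
    (hpath : ∀ l : Fin k, (qs l.castSucc = (p (idx l)).1 ∨ qs l.castSucc = (p (idx l)).2) ∧
      (qs l.succ = (p (idx l)).1 ∨ qs l.succ = (p (idx l)).2)) : reach p t i m q := by
  induction m generalizing i q k with
  | zero =>
    cases k with
    | zero => exact h0.symm.trans ht
    | succ k => have := hidx 0; omega
  | succ m ih =>
    cases k with
    | zero =>
      have : q = t := h0.symm.trans ht
      rw [this]; exact reach_self p t _ _
    | succ k =>
      by_cases hi : idx 0 = i
      · right
        have hp0 := hpath 0
        rw [hi] at hp0
        refine ⟨?_, qs (Fin.succ 0), hp0.2, ?_⟩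
        · rw [← h0]; exact hp0.1
        · refine ih (i + 1) _ k (fun l => idx l.succ) (fun l => qs l.succ) ?_ ?_ rfl ?_ ?_
          · intro a b hab
            exact hmono (Fin.succ_lt_succ_iff.mpr hab)
          · intro l
            have h1 : idx 0 < idx l.succ := hmono (Fin.succ_pos l)
            have h2 := hidx l.succ
            omega
          · rw [← ht]; rfl
          · intro l
            exact hpath l.succ
      · left
        refine ih (i + 1) q (k + 1) idx qs hmono ?_ h0 ht hpath
        intro l
        have h1 : idx 0 ≤ idx l := hmono.monotone (Fin.zero_le l)
        have h2 := hidx l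
        have h3 := hidx 0
        omega

theorem slice_lemma {n : ℕ} (p : ℕ → Fin n × Fin n) (hp : ∀ i, (p i).1 ≠ (p i).2) (t : Fin n)
    (m i : ℕ) (s : Fin n → Fin 4) (hs : s ≠ 0) (hsupp : ∀ q, s q ≠ 0 → reach p t i m q)
    (hne : ∃ q, q ≠ t ∧ reach p t i m q) :
    ∃ g : ℕ → SU4, (∀ k, IsCliffordGate (g k : Matrix (Fin 4) (Fin 4) ℂ)) ∧
      ∃ j < m, ∃ s', Tw (vp p g i (j + 1)) s s' ∧
        ∀ q, s' q ≠ 0 → q = (p (i + j)).1 ∨ q = (p (i + j)).2 := by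
  induction m generalizing i s with
  | zero =>
    obtain ⟨q, h1, h2⟩ := hne
    exact absurd h2 h1
  | succ m ih =>
    by_cases hr : ∃ r, (r = (p i).1 ∨ r = (p i).2) ∧ reach p t (i + 1) m r
    · obtain ⟨r, hr1, hr2⟩ := hr
      obtain ⟨g0, hg0, s1, htw, hs1⟩ := tw_move (p i) (hp i) r hr1 s
      have hs1' : ∀ q, s1 q ≠ 0 → reach p t (i + 1) m q := by
        intro q hq
        rcases hs1 q hq with h | ⟨h1, h2, h3⟩
        · rw [h]; exact hr2
        · rcases hsupp q h1 with h | h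
          · exact h
          · rcases h.1 with h | h
            · exact absurd h h2
            · exact absurd h h3
      by_cases hq : ∃ q, q ≠ t ∧ reach p t (i + 1) m q
      · obtain ⟨g, hg, j, hj, s', h1, h2⟩ := ih (i + 1) s1
          (htw.ne_zero (embed_isUnit _ (hp i) g0) hs) hs1' hq
        refine ⟨Function.update g i g0, ?_, j + 1, by omega, s', ?_, ?_⟩
        · intro k
          by_cases hk : k = i
          · subst hk; simpa using hg0
          · simpa [hk] using hg k
        · rw [vp, vp_congr p _ g (j + 1) (i + 1)
            (fun k h1 _ => Function.update_of_ne (by omega) _ _), Function.update_self]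
          exact htw.trans h1
        · rw [show i + (j + 1) = i + 1 + j by ring]; exact h2
      · push Not at hq
        refine ⟨fun _ => g0, fun _ => hg0, 0, by omega, s1, ?_, ?_⟩
        · simpa [vp] using htw
        · intro q h
          have e1 : q = t := by
            by_contra hqt
            exact hq q hqt (hs1' q h)
          have e2 : r = t := by
            by_contra hrt
            exact hq r hrt hr2
          rw [e1, ← e2]
          exact hr1
    · have hred : ∀ q, reach p t i (m + 1) q → reach p t (i + 1) m q := by
        intro q h
        rcases h with h | h
        · exact h
        · exact absurd h.2 hr
      obtain ⟨g, hg, j, hj, s', h1, h2⟩ := ih (i + 1) s hs (fun q h => hred q (hsupp q h))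
        (by obtain ⟨q, h1, h2⟩ := hne; exact ⟨q, h1, hred q h2⟩)
      refine ⟨Function.update g i 1, ?_, j + 1, by omega, s', ?_, ?_⟩
      · intro k
        by_cases hk : k = i
        · subst hk; simpa using clifford_one
        · simpa [hk] using hg k
      · rw [vp, vp_congr p _ g (j + 1) (i + 1)
          (fun k h1 _ => Function.update_of_ne (by omega) _ _), Function.update_self]
        have : embedGate (p i) ((1 : SU4) : Matrix (Fin 4) (Fin 4) ℂ) = 1 := embed_one _ (hp i)
        rw [this, Matrix.mul_one]
        exact h1
      · rw [show i + (j + 1) = i + 1 + j by ring]; exact h2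

theorem all_slices {n : ℕ} (p : ℕ → Fin n × Fin n) (hp : ∀ i, (p i).1 ≠ (p i).2) (hn : 2 ≤ n)
    (L T : ℕ) (hsl : ∀ k < T, ∃ t, ∀ q, reach p t (k * L) L q)
    (Q : ℕ → Fin n → Fin 4) (hQ : ∀ k < T, Q k ≠ 0) :
    ∃ g : ℕ → SU4, (∀ k, IsCliffordGate (g k : Matrix (Fin 4) (Fin 4) ℂ)) ∧
      ∀ k < T, ∃ j < T * L, ∃ s', Tw (vp p g 0 (j + 1)) (Q k) s' ∧ s' ≠ 0 ∧
        ∀ q, s' q ≠ 0 → q = (p j).1 ∨ q = (p j).2 := by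
  induction T with
  | zero => exact ⟨fun _ => 1, fun _ => clifford_one, fun k hk => absurd hk (by omega)⟩
  | succ T ih =>
    obtain ⟨g, hg, h⟩ := ih (fun k hk => hsl k (by omega)) (fun k hk => hQ k (by omega))
    obtain ⟨t, ht⟩ := hsl T (by omega)
    obtain ⟨s, hs⟩ := vp_tw p hp g hg (T * L) 0 (Q T)
    have hs0 := hs.ne_zero (vp_isUnit p hp g _ _) (hQ T (by omega))
    have hne : ∃ q, q ≠ t := by
      haveI : Nontrivial (Fin n) := Fin.nontrivial_iff_two_le.mpr hn
      exact exists_ne t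
    obtain ⟨q, hq⟩ := hne
    obtain ⟨g', hg', j, hj, s', h1, h2⟩ := slice_lemma p hp t L (T * L) s hs0 (fun q _ => ht q)
      ⟨q, hq, ht q⟩
    refine ⟨fun k => if k < T * L then g k else g' k, ?_, ?_⟩
    · intro k
      dsimp only
      split_ifs
      · exact hg k
      · exact hg' k
    · intro k hk
      have hTL : (T + 1) * L = T * L + L := by ring
      by_cases hkT : k < T
      · obtain ⟨j, hj, s', h1, h2, h3⟩ := h k hkT
        refine ⟨j, by omega, s', ?_, h2, h3⟩
        rw [vp_congr p _ g]
        · exact h1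
        · intro k _ h
          exact if_pos (by omega)
      · have hkT' : k = T := by omega
        subst hkT'
        have key : Tw (vp p (fun i => if i < k * L then g i else g' i) 0 (k * L + j + 1)) (Q k) s' := by
          rw [add_assoc, vp_add, vp_congr p _ g (k * L) 0 (fun i _ h => if_pos (by omega)),
            vp_congr p _ g' (j + 1) (0 + k * L) (fun i h _ => if_neg (by omega)), zero_add]
          exact hs.trans h1
        exact ⟨k * L + j, by omega, s', key,
          key.ne_zero (vp_isUnit p hp _ _ _) (hQ k hk), h2⟩

/-! ### The differential -/

theorem take_prod {n R : ℕ} (A : Architecture n R) (p : ℕ → Fin n × Fin n) (g : ℕ → SU4)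
    (hpA : ∀ i : Fin R, p i = (A i).1) (k : ℕ) (hk : k ≤ R) :
    ((gateList A (fun i => g i)).take k).reverse.prod = vp p g 0 k := by
  induction k with
  | zero => simp [vp]
  | succ k ih =>
    rw [vp_add, ← ih (by omega), List.take_add_one]
    have : (gateList A (fun i => g i))[k]? =
        some (embedGate (p k) (g k : Matrix (Fin 4) (Fin 4) ℂ)) := by
      have hk' : k < R := by omega
      simp only [gateList, List.getElem?_ofFn, hk', dif_pos]
      rw [← hpA ⟨k, hk'⟩]
    rw [this]
    simp [vp]

theorem diff_single {n R : ℕ} (A : Architecture n R) (x : Fin R → SU4) (j : Fin R)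
    (H : Matrix (Fin 4) (Fin 4) ℂ) :
    contractDiff A x (Pi.single j H) = ((gateList A x).drop (j + 1)).reverse.prod *
      (embedGate (A j).1 H * ((gateList A x).take (j + 1)).reverse.prod) := by
  have : ((gateList A x).take (j + 1)).reverse.prod =
    embedGate (A j).1 (x j : Matrix (Fin 4) (Fin 4) ℂ) * ((gateList A x).take j).reverse.prod := by
    rw [List.take_add_one]
    have : (gateList A x)[(j : ℕ)]? =
        some (embedGate (A j).1 (x j : Matrix (Fin 4) (Fin 4) ℂ)) := by
      simp [gateList, List.getElem?_ofFn]
    rw [this]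
    simp
  rw [this]
  simp only [contractDiff, LinearMap.sum_apply, LinearMap.comp_apply, LinearMap.proj_apply]
  rw [Finset.sum_eq_single j]
  · simp only [Pi.single_eq_same, LinearMap.mulLeft_apply, LinearMap.mulRight_apply]
    rfl
  · intro b _ hb
    rw [Pi.single_eq_of_ne hb]
    simp
  · simp

theorem rank_bound {n R T : ℕ} (A : Architecture n R) (p : ℕ → Fin n × Fin n) (g : ℕ → SU4)
    (hpA : ∀ i : Fin R, p i = (A i).1) (hp : ∀ i, (p i).1 ≠ (p i).2)
    (Q : Fin T → Fin n → Fin 4) (hQ : Function.Injective Q)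
    (h : ∀ k : Fin T, ∃ j < R, ∃ s', Tw (vp p g 0 (j + 1)) (Q k) s' ∧ s' ≠ 0 ∧
        ∀ q, s' q ≠ 0 → q = (p j).1 ∨ q = (p j).2) :
    T ≤ rankAt A (fun i => g i) := by
  set F := vp p g 0 R with hF
  have hFu : IsUnit F := vp_isUnit p hp g R 0
  have hv : ∀ k : Fin T, ∃ c : ℂ, c ≠ 0 ∧ c • (F * pauliString (Q k)) ∈
      Submodule.map (contractDiff A (fun i => g i))
        (Submodule.pi Set.univ fun _ => suAlgebra (Fin 4)) := by
    intro k
    obtain ⟨j, hj, s', ⟨c, hc, htw⟩, hs', hloc⟩ := h k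
    refine ⟨Complex.I * c⁻¹, mul_ne_zero Complex.I_ne_zero (inv_ne_zero hc), ?_⟩
    refine ⟨Pi.single ⟨j, hj⟩ (Complex.I • pauli2 ![s' (p j).1, s' (p j).2]), ?_, ?_⟩
    · intro i _
      by_cases hi : i = ⟨j, hj⟩
      · subst hi
        rw [Pi.single_eq_same]
        apply Submodule.subset_span
        constructor
        · rw [Matrix.conjTranspose_smul, pauli2_herm]; simp
        · rw [Matrix.trace_smul, pauli2_tr, smul_zero]
          intro h0
          apply hs'
          ext1 q
          by_contra hq
          have e0 := congrFun h0 0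
          have e1 := congrFun h0 1
          simp at e0 e1
          rcases hloc q hq with h | h
          · rw [h] at hq; exact hq e0
          · rw [h] at hq; exact hq e1
      · rw [Pi.single_eq_of_ne hi]; exact Submodule.zero_mem _
    · rw [diff_single, take_prod A p g hpA (j + 1) hj, ← hpA ⟨j, hj⟩]
      have e1 : embedGate (p j) (Complex.I • pauli2 ![s' (p j).1, s' (p j).2]) =
          Complex.I • pauliString s' := by
        rw [pauliString_local (p j) (hp j) s' hloc, embed_eq_gm, gm_smul, ← embed_eq_gm]
      have e2 : F = ((gateList A (fun i => g i)).drop (j + 1)).reverse.prod * vp p g 0 (j + 1) := by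
        rw [hF, ← take_prod A p g hpA R le_rfl, ← take_prod A p g hpA (j + 1) hj,
          ← List.prod_append, ← List.reverse_append, List.take_append_drop]
        congr 2
        apply List.take_of_length_le
        simp [gateList]
      have e3 : pauliString s' * vp p g 0 (j + 1) = c⁻¹ • (vp p g 0 (j + 1) * pauliString (Q k)) := by
        rw [htw, smul_smul, inv_mul_cancel₀ hc, one_smul]
      simp only []
      rw [e1, Matrix.smul_mul, e3, smul_smul, Matrix.mul_smul, e2, Matrix.mul_assoc]
  choose c hc hmem using hv
  have hli : LinearIndependent ℂ (fun k : Fin T => c k • (F * pauliString (Q k))) := by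
    have h1 := (pauliString_li n).comp Q hQ
    have h2 := h1.map_injOn (LinearMap.mulLeft ℂ F) (by
      intro a _ b _ hab
      exact hFu.mul_left_cancel hab)
    exact h2.units_smul (fun k => Units.mk0 (c k) (hc k))
  have hli' : LinearIndependent ℝ (fun k : Fin T => c k • (F * pauliString (Q k))) :=
    hli.restrict_scalars (by
      intro a b hab
      simpa using hab)
  have hli2 : LinearIndependent ℝ (fun k : Fin T =>
      (⟨c k • (F * pauliString (Q k)), hmem k⟩ : Submodule.map (contractDiff A (fun i => g i))
        (Submodule.pi Set.univ fun _ => suAlgebra (Fin 4)))) :=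
    LinearIndependent.of_comp (Submodule.subtype _) hli'
  have := hli2.fintype_card_le_finrank
  simpa [rankAt] using this

theorem le_rmax {n R : ℕ} (A : Architecture n R) (x : Fin R → SU4) : rankAt A x ≤ rmax A := by
  apply le_ciSup (f := fun x => rankAt A x)
  refine ⟨Module.finrank ℝ (NMatrix n), ?_⟩
  rintro _ ⟨y, rfl⟩
  exact Submodule.finrank_le _

end CliffordRank

/-! ## Statement 6: existence of a Clifford point of high rank -/

/-- **Existence of a high-rank Clifford point.**
Let `A` be an `n`-qubit architecture with `R = T·L` gates that is the concatenation of `T`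
consecutive causal slices of `L` gates each, with `T ≤ 4^n − 1`.  Then there is a point
`x ∈ SU(4)^{×R}` all of whose entries are Clifford gates at which the differential of the
contraction map `F^A` has rank at least `T`; in particular `r_max(A) ≥ T`. -/
theorem exists_clifford_point_of_high_rank
    (n T L : ℕ) (hn : 2 ≤ n) (hT : T ≤ 4 ^ n - 1)
    (A : Architecture n (T * L))
    (hslices : ∀ s < T, IsCausalSlice A (s * L) ((s + 1) * L)) :
    ∃ x : Fin (T * L) → SU4,
      (∀ i, IsCliffordGate (x i : Matrix (Fin 4) (Fin 4) ℂ)) ∧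
      T ≤ rankAt A x ∧ T ≤ rmax A := by
  have hcard : Fintype.card (Fin T) ≤ Fintype.card {s : Fin n → Fin 4 // s ≠ 0} := by
    rw [Fintype.card_subtype_compl]
    simpa using hT
  obtain ⟨Q⟩ := Function.Embedding.nonempty_of_card_le hcard
  let p : ℕ → Fin n × Fin n := fun i =>
    if h : i < T * L then (A ⟨i, h⟩).1 else (⟨0, by omega⟩, ⟨1, by omega⟩)
  have hpA : ∀ i : Fin (T * L), p i = (A i).1 := fun i => by simp [p]
  have hp : ∀ i, (p i).1 ≠ (p i).2 := by
    intro i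
    by_cases h : i < T * L
    · rw [hpA ⟨i, h⟩]; exact (A ⟨i, h⟩).2
    · simp [p, h]
  have hsl : ∀ k < T, ∃ t, ∀ q, CliffordRank.reach p t (k * L) L q := by
    intro k hk
    obtain ⟨t, ht⟩ := hslices k hk
    refine ⟨t, fun q => ?_⟩
    obtain ⟨m, idx, qs, h1, h2, h3, h4, h5⟩ := ht q
    refine CliffordRank.reach_path p t L (k * L) q m (fun l => (idx l : ℕ)) qs
      (fun a b hab => h1 hab) ?_ h3 h4 ?_
    · intro l
      have := h2 l
      rw [add_mul, one_mul] at this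
      exact this
    · intro l
      rw [hpA]
      exact h5 l
  obtain ⟨g, hg, hr⟩ := CliffordRank.all_slices p hp hn L T hsl
    (fun k => if h : k < T then (Q ⟨k, h⟩).1 else 0)
    (fun k hk => by simpa [hk] using (Q ⟨k, hk⟩).2)
  have hrank := CliffordRank.rank_bound A p g hpA hp (fun k => (Q k).1)
    (fun a b hab => Q.injective (Subtype.ext hab))
    (fun k => by simpa using hr k k.2)
  exact ⟨fun i => g i, fun i => hg i, hrank, hrank.trans (CliffordRank.le_rmax A _)⟩
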